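/- Let r ≥ 1 and let λ̲ = (λ_1 ≥ ⋯ ≥ λ_r ≥ 0), λ_{r+1} = 0, m_i = λ_i − λ_{i+1}. There is an explicit bijection between the set of partition overlaid patterns of type C and rank r with bounding sequence λ̲ and the set of pairs ((ℓ̲, s̲), Q), where ℓ̲ = (ℓ_1,…,ℓ_r) ∈ ℕ^r with ℓ_i ≤ m_i for all i, s̲ = (s_1,…,s_r) with each s_i a partition fitting into the rectangle (ℓ_i, m_i − ℓ_i), and Q is a restricted POP of rank r with bounding sequence (λ_1 − ℓ_1, …, λ_r − ℓ_r). The bijection sends a POP P to the pair obtained by setting ℓ_i = ℓ_{i,r̄} = λ_i − η^r_i and s_i = s_{i,r̄} for 1 ≤ i ≤ r, and letting Q be the restricted POP obtained from P by deleting the bottom row λ^r and the partitions s_{i,r̄}. -/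

import Mathlib

namespace SpWeyl

/-! ### Partitions fitting into rectangles -/

/-- A partition fitting into the rectangle `(a, b)`: a weakly increasing sequence
`s(1) ≤ ⋯ ≤ s(a)` of nonnegative integers, each at most `b`.  It is encoded as a
function `ℕ → ℕ` (with `s p` the `p`-th part, `1 ≤ p ≤ a`) vanishing outside
`{1, …, a}`. -/
def FitsRect (a b : ℕ) (s : ℕ → ℕ) : Prop :=
  (∀ p q, 1 ≤ p → p ≤ q → q ≤ a → s p ≤ s q) ∧
  (∀ p, 1 ≤ p → p ≤ a → s p ≤ b) ∧
  (∀ p, ¬(1 ≤ p ∧ p ≤ a) → s p = 0)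

noncomputable instance fitsRectFintype (a b : ℕ) : Fintype {s : ℕ → ℕ // FitsRect a b s} :=
  Fintype.ofInjective
    (fun s => (fun p : Fin a => (⟨s.1 (p + 1), by
      have h2 := s.2.2.1 (p + 1) (by omega) (by omega)
      omega⟩ : Fin (b + 1))))
    (by
      intro s t hst
      apply Subtype.ext
      funext p
      by_cases hp : 1 ≤ p ∧ p ≤ a
      · have h := congrFun hst ⟨p - 1, by omega⟩
        have h' := congrArg Fin.val h
        simpa [Nat.sub_add_cancel hp.1] using h'
      · rw [s.2.2.2 p hp, t.2.2.2 p hp])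

/-! ### Generalized Gelfand–Tsetlin patterns of type `C` -/

/-- A generalized Gelfand–Tsetlin pattern of type `C` and rank `r`: integer rows
`η¹, λ¹, η², λ², …, η^r, λ^r` with `η^j = (η^j_1, …, η^j_j)`, `λ^j = (λ^j_1, …, λ^j_j)`,
satisfying `λ^j_i ≥ η^j_i ≥ λ^j_{i+1}` for `1 ≤ i ≤ j ≤ r` (with `λ^j_{j+1} = 0`) and
`η^{j+1}_i ≥ λ^j_i ≥ η^{j+1}_{i+1}` for `1 ≤ i ≤ j < r`.  The entry `η^j_i` is `eta j i`,
and all out-of-range entries are normalized to `0`. -/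
structure PatternC (r : ℕ) where
  eta : ℕ → ℕ → ℤ
  lam : ℕ → ℕ → ℤ
  eta_supp : ∀ j i, ¬(1 ≤ i ∧ i ≤ j ∧ j ≤ r) → eta j i = 0
  lam_supp : ∀ j i, ¬(1 ≤ i ∧ i ≤ j ∧ j ≤ r) → lam j i = 0
  ineq1 : ∀ j i, 1 ≤ i → i ≤ j → j ≤ r → lam j i ≥ eta j i ∧ eta j i ≥ lam j (i + 1)
  ineq2 : ∀ j i, 1 ≤ i → i ≤ j → j < r → eta (j + 1) i ≥ lam j i ∧ lam j i ≥ eta (j + 1) (i + 1)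

/-- The difference `ℓ_{i,j̄} = λ^j_i - η^j_i`. -/
def PatternC.lbar {r : ℕ} (P : PatternC r) (i j : ℕ) : ℕ := (P.lam j i - P.eta j i).toNat

/-- The difference `ℓ′_{i,j̄} = η^j_i - λ^j_{i+1}`. -/
def PatternC.lbar' {r : ℕ} (P : PatternC r) (i j : ℕ) : ℕ := (P.eta j i - P.lam j (i + 1)).toNat

/-- The difference `ℓ_{i,j} = η^{j+1}_i - λ^j_i`. -/
def PatternC.lreg {r : ℕ} (P : PatternC r) (i j : ℕ) : ℕ := (P.eta (j + 1) i - P.lam j i).toNat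

/-- The difference `ℓ′_{i,j} = λ^j_i - η^{j+1}_{i+1}`. -/
def PatternC.lreg' {r : ℕ} (P : PatternC r) (i j : ℕ) : ℕ :=
  (P.lam j i - P.eta (j + 1) (i + 1)).toNat

/-- The bounding sequence of a pattern is its last row `λ^r`. -/
def PatternC.Bounds {r : ℕ} (P : PatternC r) (lamb : ℕ → ℕ) : Prop :=
  ∀ i, 1 ≤ i → i ≤ r → P.lam r i = (lamb i : ℤ)

/-- The coefficient `a_j = 2 Σ_{i≤j} η^j_i - Σ_{i≤j} λ^j_i - Σ_{i≤j-1} λ^{j-1}_i`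
of `ε_j` in the weight of a pattern. -/
def PatternC.aCoeff {r : ℕ} (P : PatternC r) (j : ℕ) : ℤ :=
  2 * (∑ i ∈ Finset.Icc 1 j, P.eta j i) - (∑ i ∈ Finset.Icc 1 j, P.lam j i)
    - (∑ i ∈ Finset.Icc 1 (j - 1), P.lam (j - 1) i)

/-- A partition overlaid pattern (POP) of type `C` and rank `r`: a pattern together with
partitions `s_{i,j̄}` fitting into `(ℓ_{i,j̄}, ℓ′_{i,j̄})` for `1 ≤ i ≤ j ≤ r` and
`s_{i,j}` fitting into `(ℓ_{i,j}, ℓ′_{i,j})` for `1 ≤ i ≤ j < r`. -/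
structure POPC (r : ℕ) extends PatternC r where
  sbar : ℕ → ℕ → ℕ → ℕ
  sreg : ℕ → ℕ → ℕ → ℕ
  sbar_fits : ∀ i j, 1 ≤ i → i ≤ j → j ≤ r →
    FitsRect (toPatternC.lbar i j) (toPatternC.lbar' i j) (sbar i j)
  sreg_fits : ∀ i j, 1 ≤ i → i ≤ j → j < r →
    FitsRect (toPatternC.lreg i j) (toPatternC.lreg' i j) (sreg i j)
  sbar_supp : ∀ i j, ¬(1 ≤ i ∧ i ≤ j ∧ j ≤ r) → sbar i j = fun _ => 0
  sreg_supp : ∀ i j, ¬(1 ≤ i ∧ i ≤ j ∧ j < r) → sreg i j = fun _ => 0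

/-! ### Restricted patterns -/

/-- A restricted pattern of rank `r`: rows `η¹, λ¹, …, λ^{r-1}, η^r`, satisfying
`λ^j_i ≥ η^j_i ≥ λ^j_{i+1}` and `η^{j+1}_i ≥ λ^j_i ≥ η^{j+1}_{i+1}` for `1 ≤ i ≤ j < r`. -/
structure RPattern (r : ℕ) where
  eta : ℕ → ℕ → ℤ
  lam : ℕ → ℕ → ℤ
  eta_supp : ∀ j i, ¬(1 ≤ i ∧ i ≤ j ∧ j ≤ r) → eta j i = 0
  lam_supp : ∀ j i, ¬(1 ≤ i ∧ i ≤ j ∧ j < r) → lam j i = 0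
  ineq1 : ∀ j i, 1 ≤ i → i ≤ j → j < r → lam j i ≥ eta j i ∧ eta j i ≥ lam j (i + 1)
  ineq2 : ∀ j i, 1 ≤ i → i ≤ j → j < r → eta (j + 1) i ≥ lam j i ∧ lam j i ≥ eta (j + 1) (i + 1)

def RPattern.lbar {r : ℕ} (P : RPattern r) (i j : ℕ) : ℕ := (P.lam j i - P.eta j i).toNat

def RPattern.lbar' {r : ℕ} (P : RPattern r) (i j : ℕ) : ℕ := (P.eta j i - P.lam j (i + 1)).toNat

def RPattern.lreg {r : ℕ} (P : RPattern r) (i j : ℕ) : ℕ := (P.eta (j + 1) i - P.lam j i).toNat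

def RPattern.lreg' {r : ℕ} (P : RPattern r) (i j : ℕ) : ℕ :=
  (P.lam j i - P.eta (j + 1) (i + 1)).toNat

/-- The bounding sequence of a restricted pattern is its last row `η^r`. -/
def RPattern.Bounds {r : ℕ} (P : RPattern r) (etab : ℕ → ℕ) : Prop :=
  ∀ i, 1 ≤ i → i ≤ r → P.eta r i = (etab i : ℤ)

/-- A restricted partition overlaid pattern of rank `r`: a restricted pattern together with
partitions `s_{i,j̄}` fitting into `(ℓ_{i,j̄}, ℓ′_{i,j̄})` and `s_{i,j}` fitting into
`(ℓ_{i,j}, ℓ′_{i,j})` for `1 ≤ i ≤ j < r`. -/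
structure RPOP (r : ℕ) extends RPattern r where
  sbar : ℕ → ℕ → ℕ → ℕ
  sreg : ℕ → ℕ → ℕ → ℕ
  sbar_fits : ∀ i j, 1 ≤ i → i ≤ j → j < r →
    FitsRect (toRPattern.lbar i j) (toRPattern.lbar' i j) (sbar i j)
  sreg_fits : ∀ i j, 1 ≤ i → i ≤ j → j < r →
    FitsRect (toRPattern.lreg i j) (toRPattern.lreg' i j) (sreg i j)
  sbar_supp : ∀ i j, ¬(1 ≤ i ∧ i ≤ j ∧ j < r) → sbar i j = fun _ => 0
  sreg_supp : ∀ i j, ¬(1 ≤ i ∧ i ≤ j ∧ j < r) → sreg i j = fun _ => 0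

/-- The data `(ℓ̲, s̲)` of Statement 3: `ℓ̲ = (ℓ_1, …, ℓ_r) ∈ ℕ^r` with `ℓ_i ≤ m_i`, and
`s̲ = (s_1, …, s_r)` with `s_i` a partition fitting into the rectangle `(ℓ_i, m_i - ℓ_i)`
(all data normalized to vanish outside `1 ≤ i ≤ r`). -/
structure RectData (r : ℕ) (m : ℕ → ℕ) where
  l : ℕ → ℕ
  s : ℕ → ℕ → ℕ
  l_le : ∀ i, 1 ≤ i → i ≤ r → l i ≤ m i
  l_supp : ∀ i, ¬(1 ≤ i ∧ i ≤ r) → l i = 0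
  s_fits : ∀ i, 1 ≤ i → i ≤ r → FitsRect (l i) (m i - l i) (s i)
  s_supp : ∀ i, ¬(1 ≤ i ∧ i ≤ r) → s i = fun _ => 0

theorem POPC.ext_data {r : ℕ} {P P' : POPC r} (h1 : P.eta = P'.eta) (h2 : P.lam = P'.lam)
    (h3 : P.sbar = P'.sbar) (h4 : P.sreg = P'.sreg) : P = P' := by
  obtain ⟨⟨_, _, _, _, _, _⟩, _, _, _, _, _, _⟩ := P
  obtain ⟨⟨_, _, _, _, _, _⟩, _, _, _, _, _, _⟩ := P'
  simp only at h1 h2 h3 h4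
  subst h1 h2 h3 h4
  rfl

theorem RPOP.ext_data {r : ℕ} {P P' : RPOP r} (h1 : P.eta = P'.eta) (h2 : P.lam = P'.lam)
    (h3 : P.sbar = P'.sbar) (h4 : P.sreg = P'.sreg) : P = P' := by
  obtain ⟨⟨_, _, _, _, _, _⟩, _, _, _, _, _, _⟩ := P
  obtain ⟨⟨_, _, _, _, _, _⟩, _, _, _, _, _, _⟩ := P'
  simp only at h1 h2 h3 h4
  subst h1 h2 h3 h4
  rfl

theorem RectData.ext_data {r : ℕ} {m : ℕ → ℕ} {D D' : RectData r m} (h1 : D.l = D'.l)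
    (h2 : D.s = D'.s) : D = D' := by
  obtain ⟨_, _, _, _, _, _⟩ := D
  obtain ⟨_, _, _, _, _, _⟩ := D'
  simp only at h1 h2
  subst h1 h2
  rfl

/-- The last row, extended by zero, is the bounding sequence, including `λ_{r+1} = 0`. -/
theorem PatternC.Bounds.succ {r : ℕ} {P : PatternC r} {lamb : ℕ → ℕ} (hP : P.Bounds lamb)
    (hzero : lamb (r + 1) = 0) (i : ℕ) (hi : i ≤ r) : P.lam r (i + 1) = (lamb (i + 1) : ℤ) := by
  by_cases h : i + 1 ≤ r
  · exact hP (i + 1) (by omega) h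
  · have : i = r := by omega
    subst this
    rw [hzero, P.lam_supp _ _ (by omega)]
    rfl

/-- The rectangle data of the bottom row. -/
def toRect {r : ℕ} {lamb : ℕ → ℕ} (hzero : lamb (r + 1) = 0)
    (P : POPC r) (hP : P.toPatternC.Bounds lamb) :
    RectData r (fun i => lamb i - lamb (i + 1)) where
  l i := if 1 ≤ i ∧ i ≤ r then P.toPatternC.lbar i r else 0
  s i := P.sbar i r
  l_le i h1 h2 := by
    have a := hP i h1 h2
    have b := hP.succ hzero i h2
    have c := P.ineq1 r i h1 h2 le_rfl
    simp only [h1, h2, and_self, if_true, PatternC.lbar]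
    omega
  l_supp i h := by simp only [h, if_false]
  s_fits i h1 h2 := by
    have a := hP i h1 h2
    have b := hP.succ hzero i h2
    have c := P.ineq1 r i h1 h2 le_rfl
    have d := P.sbar_fits i r h1 h2 le_rfl
    simp only [h1, h2, and_self, if_true]
    convert d using 1
    simp only [PatternC.lbar, PatternC.lbar']
    omega
  s_supp i h := P.sbar_supp i r (by omega)

/-- Deleting the bottom row. -/
def toRPOP {r : ℕ} (P : POPC r) : RPOP r where
  eta := P.eta
  lam j i := if j < r then P.lam j i else 0
  eta_supp := P.eta_supp
  lam_supp j i h := by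
    split_ifs with hj
    · exact P.lam_supp j i (by omega)
    · rfl
  ineq1 j i h1 h2 h3 := by
    simp only [h3, if_true]
    exact P.ineq1 j i h1 h2 h3.le
  ineq2 j i h1 h2 h3 := by
    simp only [h3, if_true]
    exact P.ineq2 j i h1 h2 h3
  sbar i j := if j < r then P.sbar i j else fun _ => 0
  sreg := P.sreg
  sbar_fits i j h1 h2 h3 := by
    simp only [h3, if_true, RPattern.lbar, RPattern.lbar']
    exact P.sbar_fits i j h1 h2 h3.le
  sreg_fits i j h1 h2 h3 := by
    simp only [h3, if_true, RPattern.lreg, RPattern.lreg']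
    exact P.sreg_fits i j h1 h2 h3
  sbar_supp i j h := by
    split_ifs with hj
    · exact P.sbar_supp i j (by omega)
    · rfl
  sreg_supp := P.sreg_supp

/-- Gluing the bottom row back. -/
def glue {r : ℕ} {lamb : ℕ → ℕ} (hdec : ∀ i, 1 ≤ i → i ≤ r → lamb (i + 1) ≤ lamb i)
    (hzero : lamb (r + 1) = 0) (D : RectData r (fun i => lamb i - lamb (i + 1))) (Q : RPOP r)
    (hQ : Q.toRPattern.Bounds (fun i => lamb i - D.l i)) : POPC r where
  eta := Q.eta
  lam j i := if j = r then (if 1 ≤ i ∧ i ≤ r then (lamb i : ℤ) else 0) else Q.lam j i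
  eta_supp := Q.eta_supp
  lam_supp j i h := by
    split_ifs with hj hi
    · omega
    · rfl
    · exact Q.lam_supp j i (by omega)
  ineq1 j i h1 h2 h3 := by
    by_cases hj : j = r
    · subst hj
      have a := hQ i h1 h2
      have b := D.l_le i h1 h2
      have c := hdec i h1 h2
      simp only at a b
      simp only [if_true]
      by_cases hi : i = j
      · subst hi
        split_ifs <;> omega
      · split_ifs <;> omega
    · simp only [hj, if_false]
      exact Q.ineq1 j i h1 h2 (by omega)
  ineq2 j i h1 h2 h3 := by
    simp only [h3.ne, if_false]
    exact Q.ineq2 j i h1 h2 h3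
  sbar i j := if j = r then D.s i else Q.sbar i j
  sreg := Q.sreg
  sbar_fits i j h1 h2 h3 := by
    by_cases hj : j = r
    · subst hj
      have a := hQ i h1 h2
      have b := D.l_le i h1 h2
      have c := hdec i h1 h2
      have d := D.s_fits i h1 h2
      simp only at a b d
      simp only [if_true, PatternC.lbar, PatternC.lbar']
      convert d using 1
      · split_ifs <;> omega
      · by_cases hi : i = j
        · subst hi
          split_ifs <;> omega
        · split_ifs <;> omega
    · simp only [hj, if_false, PatternC.lbar, PatternC.lbar']
      exact Q.sbar_fits i j h1 h2 (by omega)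
  sreg_fits i j h1 h2 h3 := by
    simp only [h3.ne, if_false, PatternC.lreg, PatternC.lreg']
    exact Q.sreg_fits i j h1 h2 h3
  sbar_supp i j h := by
    split_ifs with hj
    · exact D.s_supp i (by omega)
    · exact Q.sbar_supp i j (by omega)
  sreg_supp := Q.sreg_supp

/-- The bijection of the theorem. -/
def popEquiv (r : ℕ) (lamb : ℕ → ℕ)
    (hdec : ∀ i, 1 ≤ i → i ≤ r → lamb (i + 1) ≤ lamb i) (hzero : lamb (r + 1) = 0) :
    {P : POPC r // P.toPatternC.Bounds lamb} ≃
      {D : RectData r (fun i => lamb i - lamb (i + 1)) ×' RPOP r //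
        D.2.toRPattern.Bounds (fun i => lamb i - D.1.l i)} where
  toFun P := ⟨⟨toRect hzero P.1 P.2, toRPOP P.1⟩, by
    intro i h1 h2
    have a := P.2 i h1 h2
    have b := P.2.succ hzero i h2
    have c := P.1.ineq1 r i h1 h2 le_rfl
    simp only [toRect, toRPOP, h1, h2, and_self, if_true, PatternC.lbar]
    omega⟩
  invFun D := ⟨glue hdec hzero D.1.1 D.1.2 D.2, by
    intro i h1 h2
    simp only [glue, h1, h2, and_self, if_true]⟩
  left_inv P := by
    apply Subtype.ext
    apply POPC.ext_data
    · rfl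
    · funext j i
      simp only [glue, toRPOP]
      split_ifs with h1 h2 h3
      · subst h1
        exact (P.2 i h2.1 h2.2).symm
      · exact (P.1.lam_supp j i (by omega)).symm
      · rfl
      · exact (P.1.lam_supp j i (by omega)).symm
    · funext i j
      simp only [glue, toRPOP, toRect]
      split_ifs with h1 h2
      · rw [h1]
      · rfl
      · exact (P.1.sbar_supp i j (by omega)).symm
    · rfl
  right_inv D := by
    obtain ⟨⟨D, Q⟩, hQ⟩ := D
    apply Subtype.ext
    have e1 : toRect hzero (glue hdec hzero D Q hQ) (by
        intro i h1 h2
        simp only [glue, h1, h2, and_self, if_true]) = D := by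
      apply RectData.ext_data
      · funext i
        simp only [toRect]
        split_ifs with h
        · have a := hQ i h.1 h.2
          have b := D.l_le i h.1 h.2
          simp only at a b
          simp only [glue, PatternC.lbar, h, and_self, if_true]
          omega
        · exact (D.l_supp i h).symm
      · funext i
        simp only [toRect, glue, if_true]
    have e2 : toRPOP (glue hdec hzero D Q hQ) = Q := by
      apply RPOP.ext_data
      · rfl
      · funext j i
        simp only [glue, toRPOP]
        split_ifs with h1 h2 h3
        · omega
        · omega
        · rfl
        · exact (Q.lam_supp j i (by omega)).symm
      · funext i j
        simp only [glue, toRPOP]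
        split_ifs with h1 h2
        · omega
        · rfl
        · exact (Q.sbar_supp i j (by omega)).symm
      · rfl
    simp only [e1, e2]

/-- For `λ̲ = (λ_1 ≥ ⋯ ≥ λ_r ≥ 0)`, `λ_{r+1} = 0`, `m_i = λ_i − λ_{i+1}`,
there is a bijection between the POPs of type `C` and rank `r` with bounding sequence `λ̲`
and the pairs `((ℓ̲, s̲), Q)` where `ℓ_i ≤ m_i`, `s_i` fits into `(ℓ_i, m_i − ℓ_i)`, and `Q`
is a restricted POP of rank `r` with bounding sequence `(λ_1 − ℓ_1, …, λ_r − ℓ_r)`.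
It sends a POP `P` to the pair with `ℓ_i = ℓ_{i,r̄} = λ_i − η^r_i`, `s_i = s_{i,r̄}`, and
`Q` obtained from `P` by deleting the bottom row `λ^r` and the partitions `s_{i,r̄}`. -/
theorem pop_decomposition (r : ℕ) (hr : 1 ≤ r) (lamb : ℕ → ℕ)
    (hdec : ∀ i, 1 ≤ i → i ≤ r → lamb (i + 1) ≤ lamb i) (hzero : lamb (r + 1) = 0) :
    ∃ e : {P : POPC r // P.toPatternC.Bounds lamb} ≃
        {D : RectData r (fun i => lamb i - lamb (i + 1)) ×' RPOP r //
          D.2.toRPattern.Bounds (fun i => lamb i - D.1.l i)},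
      ∀ P : {P : POPC r // P.toPatternC.Bounds lamb},
        (∀ i, 1 ≤ i → i ≤ r → (e P).1.1.l i = P.1.toPatternC.lbar i r) ∧
        (∀ i, 1 ≤ i → i ≤ r → (e P).1.1.s i = P.1.sbar i r) ∧
        ((e P).1.2.eta = P.1.eta) ∧
        (∀ j i, j < r → (e P).1.2.lam j i = P.1.lam j i) ∧
        (∀ i j, j < r → (e P).1.2.sbar i j = P.1.sbar i j) ∧
        ((e P).1.2.sreg = P.1.sreg) := by
  refine ⟨popEquiv r lamb hdec hzero, fun P => ⟨?_, ?_, rfl, ?_, ?_, rfl⟩⟩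
  · intro i h1 h2
    simp only [popEquiv, Equiv.coe_fn_mk, toRect, h1, h2, and_self, if_true]
  · intro i h1 h2
    rfl
  · intro j i h
    simp only [popEquiv, Equiv.coe_fn_mk, toRPOP, h, if_true]
  · intro i j h
    simp only [popEquiv, Equiv.coe_fn_mk, toRPOP, h, if_true]

end SpWeyl
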